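/- Let p, q > 0, and let f be a function analytic on the domain D^{bp} := ℂ∖(−∞,0] such that f(z) = G_{β'_{p,q}}(z) for all z in the upper half-plane ℂ⁺. Then for every z ∈ D^{bp} with Im f(z) < 0, the derivative f'(z) is nonzero. -/

import Mathlib

open MeasureTheory Complex Set

/-- The Cauchy transform `∫ 1/(z-x) dμ(x)` of a measure on ℝ. -/
noncomputable def cauchyT (μ : Measure ℝ) (z : ℂ) : ℂ := ∫ x, (z - (x : ℂ))⁻¹ ∂μ

/-- The Euler beta function `B(p,q) = ∫₀¹ x^(p-1) (1-x)^(q-1) dx`. -/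
noncomputable def betaFun (p q : ℝ) : ℝ := ∫ x in Ioo (0:ℝ) 1, x ^ (p - 1) * (1 - x) ^ (q - 1)

/-- The beta prime distribution `β'_{p,q}` on `[0,∞)`. -/
noncomputable def betaPrimeMeasure (p q : ℝ) : Measure ℝ :=
  volume.withDensity fun x =>
    ENNReal.ofReal ((Ioi (0:ℝ)).indicator
      (fun x => x ^ (p - 1) * (1 + x) ^ (-(p + q)) / betaFun p q) x)

/-- The domain `D^{bp} = ℂ ∖ (-∞,0]`. -/
def betaPrimeDomain : Set ℂ := {z : ℂ | ¬ (z.im = 0 ∧ z.re ≤ 0)}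

/-- The unnormalised beta prime weight `x^s (1+x)^(-t)`. -/
noncomputable def betaPrimeWeight (s t x : ℝ) : ℝ := x ^ s * (1 + x) ^ (-t)

lemma betaPrimeWeight_pos (s t : ℝ) {x : ℝ} (hx : 0 < x) : 0 < betaPrimeWeight s t x := by
  unfold betaPrimeWeight
  positivity

@[fun_prop]
lemma measurable_betaPrimeWeight (s t : ℝ) : Measurable (betaPrimeWeight s t) := by
  unfold betaPrimeWeight
  fun_prop

lemma one_add_rpow_neg_le {t x : ℝ} (ht : 0 ≤ t) (hx : 0 < x) : (1 + x) ^ (-t) ≤ x ^ (-t) :=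
  Real.rpow_le_rpow_of_nonpos hx (by linarith) (by linarith)

lemma integrableOn_betaPrimeWeight {s t : ℝ} (hs : -1 < s) (ht : s + 1 < t) :
    IntegrableOn (betaPrimeWeight s t) (Ioi 0) := by
  have ht0 : 0 ≤ t := by linarith
  rw [← Ioc_union_Ioi_eq_Ioi (zero_le_one (α := ℝ))]
  refine IntegrableOn.union ?_ ?_
  · have h : IntegrableOn (fun x : ℝ => x ^ s) (Ioc 0 1) := by
      rw [integrableOn_Ioc_iff_integrableOn_Ioo]
      exact (intervalIntegral.integrableOn_Ioo_rpow_iff one_pos).2 hs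
    refine Integrable.mono' h (by fun_prop) ?_
    refine ae_restrict_of_forall_mem measurableSet_Ioc fun x hx => ?_
    rw [Real.norm_of_nonneg (betaPrimeWeight_pos s t hx.1).le, betaPrimeWeight]
    exact mul_le_of_le_one_right (Real.rpow_nonneg hx.1.le _)
      (Real.rpow_le_one_of_one_le_of_nonpos (by linarith [hx.1]) (by linarith))
  · refine Integrable.mono' (integrableOn_Ioi_rpow_of_lt (a := s - t) (by linarith) one_pos)
      (by fun_prop) ?_
    refine ae_restrict_of_forall_mem measurableSet_Ioi fun x hx => ?_
    have hx0 : 0 < x := lt_trans one_pos hx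
    rw [Real.norm_of_nonneg (betaPrimeWeight_pos s t hx0).le, betaPrimeWeight, sub_eq_add_neg,
      Real.rpow_add hx0]
    exact mul_le_mul_of_nonneg_left (one_add_rpow_neg_le ht0 hx0) (Real.rpow_nonneg hx0.le _)

lemma im_le_norm_sub_ofReal (z : ℂ) (x : ℝ) : z.im ≤ ‖z - x‖ := by
  simpa using (le_abs_self _).trans (abs_im_le_norm (z - x))

lemma sub_ofReal_ne_zero {z : ℂ} (hz : 0 < z.im) (x : ℝ) : z - x ≠ 0 :=
  norm_pos_iff.1 (hz.trans_le (im_le_norm_sub_ofReal z x))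

lemma norm_inv_sub_ofReal_le {z : ℂ} (hz : 0 < z.im) (x : ℝ) : ‖(z - x)⁻¹‖ ≤ z.im⁻¹ := by
  rw [norm_inv]
  exact inv_anti₀ hz (im_le_norm_sub_ofReal z x)

lemma im_inv_sub_ofReal_neg {z : ℂ} (hz : 0 < z.im) (x : ℝ) : ((z - x)⁻¹).im < 0 := by
  rw [inv_im]
  have := normSq_pos.2 (sub_ofReal_ne_zero hz x)
  exact div_neg_of_neg_of_pos (by simpa using hz) this

lemma ofReal_mul_inv_sub {z : ℂ} (hz : 0 < z.im) (x : ℝ) :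
    (x : ℂ) * (z - x)⁻¹ = z * (z - x)⁻¹ - 1 := by
  field_simp [sub_ofReal_ne_zero hz x]
  ring

/-- Continuous functions of the resolvent `(z-x)⁻¹` are integrable against integrable weights. -/
lemma integrableOn_mul_comp_inv {v : ℝ → ℝ} {S : Set ℝ} (hv : IntegrableOn v S) {z : ℂ}
    (hz : 0 < z.im) {P : ℂ → ℂ} (hP : Continuous P) :
    IntegrableOn (fun x => (v x : ℂ) * P (z - x)⁻¹) S := by
  obtain ⟨C, hC⟩ := (isCompact_closedBall (0 : ℂ) z.im⁻¹).exists_bound_of_continuousOn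
    hP.continuousOn
  have hm : Measurable fun x : ℝ => P (z - x)⁻¹ := by fun_prop
  simp only [mul_comm (Complex.ofReal _)]
  refine Integrable.bdd_mul (c := C) hv.ofReal hm.aestronglyMeasurable (.of_forall fun x => ?_)
  exact hC _ (by simpa using norm_inv_sub_ofReal_le hz x)

lemma hasDerivAt_betaPrimeWeight (a b : ℝ) {x : ℝ} (hx : 0 < x) :
    HasDerivAt (betaPrimeWeight a b)
      (betaPrimeWeight (a - 1) (b + 1) x * (a + (a - b) * x)) x := by
  have hx1 : 0 < 1 + x := by linarith
  have h1 := Real.hasDerivAt_rpow_const (p := a) (Or.inl hx.ne')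
  have h2 := ((hasDerivAt_id x).const_add 1).rpow_const (p := -b) (Or.inl hx1.ne')
  refine (h1.mul h2).congr_deriv ?_
  have e1 : x ^ a = x ^ (a - 1) * x := by
    rw [← Real.rpow_add_one hx.ne']; ring_nf
  have e2 : (1 + x) ^ (-b) = (1 + x) ^ (-(b + 1)) * (1 + x) := by
    rw [← Real.rpow_add_one hx1.ne']; ring_nf
  have e3 : (1 + x) ^ (-b - 1) = (1 + x) ^ (-(b + 1)) := by ring_nf
  simp only [id, betaPrimeWeight, e1, e2, e3]
  ring

lemma betaPrimeWeight_eq_mul (a b : ℝ) {x : ℝ} (hx : 0 < x) :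
    betaPrimeWeight a b x = betaPrimeWeight (a - 1) (b + 1) x * (x * (1 + x)) := by
  have hx1 : 0 < 1 + x := by linarith
  have e1 : x ^ a = x ^ (a - 1) * x := by
    rw [← Real.rpow_add_one hx.ne']; ring_nf
  have e2 : (1 + x) ^ (-b) = (1 + x) ^ (-(b + 1)) * (1 + x) := by
    rw [← Real.rpow_add_one hx1.ne']; ring_nf
  simp only [betaPrimeWeight, e1, e2]
  ring

/-- Integration by parts for `x^a (1+x)^(-b) / (z-x)`, written through the resolvent. -/
lemma integral_betaPrimeWeight_by_parts {a b : ℝ} (ha : 0 < a) (hab : a - 1 < b) {z : ℂ}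
    (hz : 0 < z.im) :
    ∫ x in Ioi (0 : ℝ), (betaPrimeWeight (a - 1) (b + 1) x : ℂ) *
      ((a * (z - x)⁻¹ + (a - b) * (z * (z - x)⁻¹ - 1)) +
        (z * (z - x)⁻¹ - 1) * ((z - x)⁻¹ + z * (z - x)⁻¹ - 1)) = 0 := by
  have hint := integrableOn_mul_comp_inv
    (integrableOn_betaPrimeWeight (s := a - 1) (t := b + 1) (by linarith) (by linarith)) hz
    (P := fun u => (a * u + (a - b) * (z * u - 1)) + (z * u - 1) * (u + z * u - 1)) (by fun_prop)
  have key := integral_Ioi_of_hasDerivAt_of_tendsto (m := 0)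
    (f := fun x : ℝ => (betaPrimeWeight a b x : ℂ) * (z - x)⁻¹) ?_ ?_ hint ?_
  · rw [key]
    simp [betaPrimeWeight, Real.zero_rpow ha.ne']
  · refine ContinuousAt.continuousWithinAt ?_
    have : ContinuousAt (betaPrimeWeight a b) 0 := by
      unfold betaPrimeWeight
      refine (Real.continuousAt_rpow_const _ _ (Or.inr ha.le)).mul ?_
      exact ContinuousAt.rpow_const (by fun_prop) (Or.inl (by norm_num))
    have h0 := sub_ofReal_ne_zero hz 0
    exact (continuous_ofReal.continuousAt.comp this).mul
      (ContinuousAt.inv₀ (by fun_prop) h0)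
  · intro x hx
    have h0 := sub_ofReal_ne_zero hz x
    have h1 := (hasDerivAt_betaPrimeWeight a b hx).ofReal_comp
    have h2 : HasDerivAt (fun x : ℝ => (z - x)⁻¹) _ x :=
      ((hasDerivAt_id x).ofReal_comp.const_sub z).fun_inv h0
    refine (h1.mul h2).congr_deriv ?_
    simp only [← ofReal_mul_inv_sub hz x]
    rw [betaPrimeWeight_eq_mul a b hx]
    simp only [id]
    push_cast
    field_simp
    ring
  · rw [tendsto_zero_iff_norm_tendsto_zero]
    have hx1 : Filter.Tendsto (fun x : ℝ => (1 + ‖1 + z‖ * z.im⁻¹) * x ^ (-(b + 1 - a)))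
        Filter.atTop (nhds 0) := by
      simpa using (tendsto_rpow_neg_atTop (y := b + 1 - a) (by linarith)).const_mul
        (1 + ‖1 + z‖ * z.im⁻¹)
    refine squeeze_zero' (.of_forall fun x => norm_nonneg _) ?_ hx1
    filter_upwards [Filter.eventually_gt_atTop 0] with x hx
    have hxp : 0 < 1 + x := by linarith
    have e : (betaPrimeWeight a b x : ℂ) * (z - x)⁻¹ =
        (betaPrimeWeight a (b + 1) x : ℂ) * (-1 + (1 + z) * (z - x)⁻¹) := by
      have e2 : (1 + x) ^ (-b) = (1 + x) ^ (-(b + 1)) * (1 + x) := by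
        rw [← Real.rpow_add_one hxp.ne']; ring_nf
      have h0 := sub_ofReal_ne_zero hz x
      simp only [betaPrimeWeight, e2]
      push_cast
      field_simp
      ring
    rw [e, norm_mul, norm_real, Real.norm_of_nonneg (betaPrimeWeight_pos _ _ hx).le, mul_comm]
    refine mul_le_mul ?_ ?_ (betaPrimeWeight_pos _ _ hx).le (by positivity)
    · refine (norm_add_le _ _).trans ?_
      rw [norm_neg, norm_one, norm_mul]
      gcongr
      exact norm_inv_sub_ofReal_le hz x
    · rw [betaPrimeWeight, show -(b + 1 - a) = a + -(b + 1) by ring, Real.rpow_add hx]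
      exact mul_le_mul_of_nonneg_left (one_add_rpow_neg_le (by linarith) hx)
        (Real.rpow_nonneg hx.le _)

/-- An integral over `(0,∞)` has positive imaginary part if the integrand has nonnegative imaginary
part, positive beyond some point. -/
lemma integral_im_pos {g : ℝ → ℂ} (hg : IntegrableOn g (Ioi 0)) (c : ℝ)
    (h0 : ∀ x, 0 < x → 0 ≤ (g x).im) (hc : ∀ x, 0 < x → c < x → 0 < (g x).im) :
    0 < (∫ x in Ioi (0 : ℝ), g x).im := by
  have e := integral_im (μ := volume.restrict (Ioi (0 : ℝ))) hg
  simp only [RCLike.im_to_complex] at e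
  rw [← e, setIntegral_pos_iff_support_of_nonneg_ae
    (ae_restrict_of_forall_mem measurableSet_Ioi h0) hg.im]
  refine lt_of_lt_of_le (?_ : 0 < volume (Ioi (max 0 c))) (measure_mono fun x hx => ?_)
  · simp
  · rw [mem_Ioi, max_lt_iff] at hx
    exact ⟨(hc x hx.1 hx.2).ne', hx.1⟩

lemma integral_betaPrimeWeight_pos {s t : ℝ} (hs : -1 < s) (ht : s + 1 < t) :
    0 < ∫ x in Ioi (0 : ℝ), betaPrimeWeight s t x := by
  rw [setIntegral_pos_iff_support_of_nonneg_ae (ae_restrict_of_forall_mem measurableSet_Ioi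
    fun x hx => (betaPrimeWeight_pos s t hx).le) (integrableOn_betaPrimeWeight hs ht)]
  refine lt_of_lt_of_le (?_ : 0 < volume (Ioi (0 : ℝ))) (measure_mono fun x hx => ?_)
  · simp
  · exact ⟨(betaPrimeWeight_pos s t hx).ne', hx⟩

/-- The second moment of the resolvent against the weight does not vanish: the weight is
unimodal. -/
lemma integral_betaPrimeWeight_mul_inv_sq_ne_zero {p q : ℝ} (hp : 0 < p) (hq : 0 < q) {z : ℂ}
    (hz : 0 < z.im) :
    ∫ x in Ioi (0 : ℝ), (betaPrimeWeight (p - 1) (p + q) x : ℂ) * (z - x)⁻¹ ^ 2 ≠ 0 := by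
  intro hzero
  have hw := integrableOn_betaPrimeWeight (s := p - 1) (t := p + q) (by linarith) (by linarith)
  have hsq := integrableOn_mul_comp_inv hw hz (P := fun u => u ^ 2) (by fun_prop)
  rcases le_or_gt p 1 with hp1 | hp1
  · have hI := integral_betaPrimeWeight_by_parts (a := p) (b := p + q - 1) hp (by linarith) hz
    have hg := integrableOn_mul_comp_inv hw hz
      (P := fun u => (p - 1 - (q + 1) * z) * u + q) (by fun_prop)
    have hsplit : ∫ x in Ioi (0 : ℝ), (betaPrimeWeight (p - 1) (p + q) x : ℂ) *
        ((p - 1 - (q + 1) * z) * (z - x)⁻¹ + q) = 0 := by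
      rw [← hI, ← add_zero (∫ x in Ioi (0 : ℝ), _), ← mul_zero (z * (1 + z)), ← hzero,
        ← integral_const_mul, ← integral_add hg (hsq.const_mul _)]
      congr 1 with x
      rw [sub_add_cancel]
      push_cast
      ring
    have him : ∀ x : ℝ, 0 < x → 0 < ((betaPrimeWeight (p - 1) (p + q) x : ℂ) *
        ((p - 1 - (q + 1) * z) * (z - x)⁻¹ + q)).im := by
      intro x hx
      have e : (p - 1 - (q + 1) * z) * (z - x)⁻¹ + q =
          ((p - 1 - (q + 1) * x : ℝ) : ℂ) * (z - x)⁻¹ - 1 := by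
        have := ofReal_mul_inv_sub hz x
        push_cast
        linear_combination (q + 1) * this
      rw [e, im_ofReal_mul, sub_im, im_ofReal_mul, one_im, sub_zero]
      have : 0 < (q + 1) * x := by positivity
      exact mul_pos (betaPrimeWeight_pos _ _ hx)
        (mul_pos_of_neg_of_neg (by linarith) (im_inv_sub_ofReal_neg hz x))
    have := integral_im_pos hg 0 (fun x hx => (him x hx).le) fun x hx _ => him x hx
    simp [hsplit] at this
  · have hI := integral_betaPrimeWeight_by_parts (a := p - 1) (b := p + q) (by linarith)
      (by linarith) hz
    have hv := integrableOn_betaPrimeWeight (s := p - 1 - 1) (t := p + q + 1) (by linarith)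
      (by linarith)
    set c : ℝ := (p - 1) / (q + 1) with hc
    have hpc : p - 1 = (q + 1) * c := by rw [hc]; field_simp
    have hpcC : (p : ℂ) - 1 = (q + 1) * c := by exact_mod_cast hpc
    have hg := integrableOn_mul_comp_inv hv hz
      (P := fun u => (z - c) * ((p - 1) * u - (q + 1) * (z * u - 1))) (by fun_prop)
    have hsplit : ∫ x in Ioi (0 : ℝ), (betaPrimeWeight (p - 1 - 1) (p + q + 1) x : ℂ) *
        ((z - c) * ((p - 1) * (z - x)⁻¹ - (q + 1) * (z * (z - x)⁻¹ - 1))) = 0 := by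
      rw [← mul_zero (z - c), ← hI, ← add_zero (∫ x in Ioi (0 : ℝ), _), ← mul_zero (z - c),
        ← hzero, ← integral_const_mul, ← integral_const_mul, ← integral_add hg (hsq.const_mul _)]
      refine setIntegral_congr_fun measurableSet_Ioi fun x hx => ?_
      simp only [betaPrimeWeight_eq_mul (p - 1) (p + q) hx, ← ofReal_mul_inv_sub hz x]
      rw [add_sub_assoc, ← ofReal_mul_inv_sub hz x]
      push_cast
      ring
    have him : ∀ x : ℝ, ((betaPrimeWeight (p - 1 - 1) (p + q + 1) x : ℂ) *
        ((z - c) * ((p - 1) * (z - x)⁻¹ - (q + 1) * (z * (z - x)⁻¹ - 1)))).im =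
        betaPrimeWeight (p - 1 - 1) (p + q + 1) x *
          ((q + 1) * (x - c) ^ 2 * -((z - x)⁻¹).im) := by
      intro x
      have e : (z - c) * ((p - 1) * (z - x)⁻¹ - (q + 1) * (z * (z - x)⁻¹ - 1)) =
          (((q + 1) * (c - x) : ℝ) : ℂ) + ((-((q + 1) * (x - c) ^ 2) : ℝ) : ℂ) * (z - x)⁻¹ := by
        have h0 := sub_ofReal_ne_zero hz x
        rw [hpcC]
        push_cast
        field_simp
        ring
      rw [e, im_ofReal_mul, add_im, im_ofReal_mul, ofReal_im]
      ring
    have := integral_im_pos hg c (fun x hx => ?_) fun x hx hcx => ?_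
    · simp [hsplit] at this
    · rw [him]
      have h1 := im_inv_sub_ofReal_neg hz x
      have h2 := betaPrimeWeight_pos (p - 1 - 1) (p + q + 1) hx
      exact mul_nonneg h2.le (mul_nonneg (by positivity) (by linarith))
    · rw [him]
      have h1 := im_inv_sub_ofReal_neg hz x
      have h2 := betaPrimeWeight_pos (p - 1 - 1) (p + q + 1) hx
      have h3 : 0 < x - c := sub_pos.2 hcx
      exact mul_pos h2 (mul_pos (by positivity) (by linarith))

lemma hasDerivAt_integral_mul_inv_sub {v : ℝ → ℝ} {S : Set ℝ} (hv : IntegrableOn v S) {z : ℂ}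
    (hz : 0 < z.im) :
    HasDerivAt (fun z : ℂ => ∫ x in S, (v x : ℂ) * (z - x)⁻¹)
      (-∫ x in S, (v x : ℂ) * (z - x)⁻¹ ^ 2) z := by
  have hpos : ∀ w ∈ {w : ℂ | z.im / 2 < w.im}, 0 < w.im := fun w hw => by
    have : z.im / 2 < w.im := hw
    linarith
  have hs : {w : ℂ | z.im / 2 < w.im} ∈ nhds z :=
    (isOpen_lt continuous_const continuous_im).mem_nhds (by simpa using hz)
  have hint : ∀ w : ℂ, 0 < w.im → ∀ n : ℕ, IntegrableOn (fun x => (v x : ℂ) * (w - x)⁻¹ ^ n) S :=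
    fun w hw n => integrableOn_mul_comp_inv hv hw (P := fun u => u ^ n) (by fun_prop)
  have hint1 : ∀ w : ℂ, 0 < w.im → IntegrableOn (fun x => (v x : ℂ) * (w - x)⁻¹) S :=
    fun w hw => by simpa using hint w hw 1
  rw [← integral_neg]
  refine (hasDerivAt_integral_of_dominated_loc_of_deriv_le
    (𝕜 := ℂ) (F := fun w x => (v x : ℂ) * (w - x)⁻¹) (bound := fun x => ‖v x‖ * (z.im / 2)⁻¹ ^ 2)
    (F' := fun w x => -((v x : ℂ) * (w - x)⁻¹ ^ 2)) hs ?_ (hint1 z hz)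
    (hint z hz 2).neg.aestronglyMeasurable ?_ (hv.norm.mul_const _) ?_).2
  · filter_upwards [hs] with w hw using (hint1 w (hpos w hw)).aestronglyMeasurable
  · refine .of_forall fun x w hw => ?_
    rw [norm_neg, norm_mul, norm_pow, norm_real]
    gcongr
    exact (norm_inv_sub_ofReal_le (hpos w hw) x).trans
      (inv_anti₀ (by linarith) (le_of_lt hw))
  · refine .of_forall fun x w hw => ?_
    have h0 := sub_ofReal_ne_zero (hpos w hw) x
    refine ((((hasDerivAt_id w).sub_const (x : ℂ)).fun_inv h0).const_mul (v x : ℂ)).congr_deriv ?_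
    simp only [id]
    field_simp

lemma betaFun_eq_beta {p q : ℝ} (hp : 0 < p) (hq : 0 < q) :
    betaFun p q = ProbabilityTheory.beta p q := by
  rw [ProbabilityTheory.beta_eq_betaIntegralReal p q hp hq, betaFun, betaIntegral,
    intervalIntegral.integral_of_le zero_le_one, ← integral_Ioc_eq_integral_Ioo,
    ← RCLike.re_to_complex, ← integral_re]
  · refine setIntegral_congr_fun measurableSet_Ioc fun x hx => ?_
    have h1 : 0 ≤ 1 - x := by linarith [hx.2]
    norm_cast
    rw [← ofReal_cpow hx.1.le, ← ofReal_cpow h1, RCLike.re_to_complex, re_mul_ofReal, ofReal_re]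
  · have := betaIntegral_convergent (u := p) (v := q) (by simpa) (by simpa)
    rwa [intervalIntegrable_iff_integrableOn_Ioc_of_le zero_le_one] at this

lemma cauchyT_betaPrimeMeasure (p q : ℝ) (hB : 0 < betaFun p q) (z : ℂ) :
    cauchyT (betaPrimeMeasure p q) z = (betaFun p q : ℂ)⁻¹ *
      ∫ x in Ioi (0 : ℝ), (betaPrimeWeight (p - 1) (p + q) x : ℂ) * (z - x)⁻¹ := by
  have hm : Measurable fun x : ℝ => ENNReal.ofReal ((Ioi (0:ℝ)).indicator
      (fun x => x ^ (p - 1) * (1 + x) ^ (-(p + q)) / betaFun p q) x) :=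
    ((Measurable.indicator (by fun_prop) measurableSet_Ioi)).ennreal_ofReal
  rw [cauchyT, betaPrimeMeasure, integral_withDensity_eq_integral_toReal_smul hm
    (.of_forall fun _ => ENNReal.ofReal_lt_top), ← integral_const_mul,
    ← integral_indicator measurableSet_Ioi]
  congr 1 with x
  by_cases hx : x ∈ Ioi (0 : ℝ)
  · have h := div_nonneg (betaPrimeWeight_pos (p - 1) (p + q) hx).le hB.le
    simp only [indicator_of_mem hx]
    rw [← betaPrimeWeight, ENNReal.toReal_ofReal h, real_smul]
    push_cast
    ring
  · simp [indicator_of_notMem hx]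

lemma betaPrimeDomain_eq_slitPlane : betaPrimeDomain = slitPlane := by
  ext z
  simp only [betaPrimeDomain, mem_ofPred_eq, mem_slitPlane_iff]
  rw [not_and_or, not_le, or_comm]

/-- The Cauchy transform of the beta prime distribution, analytically continued, satisfies a first
order linear differential equation with positive inhomogeneity. -/
lemma exists_betaPrime_ode {p q : ℝ} (hp : 0 < p) (hq : 0 < q)
    {f : ℂ → ℂ} (hf : AnalyticOnNhd ℂ f betaPrimeDomain)
    (hd : ∀ z : ℂ, 0 < z.im → HasDerivAt f (-((betaFun p q : ℂ)⁻¹ * ∫ x in Ioi (0 : ℝ),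
      (betaPrimeWeight (p - 1) (p + q) x : ℂ) * (z - x)⁻¹ ^ 2)) z)
    (hagree : ∀ z : ℂ, 0 < z.im → f z = (betaFun p q : ℂ)⁻¹ *
      ∫ x in Ioi (0 : ℝ), (betaPrimeWeight (p - 1) (p + q) x : ℂ) * (z - x)⁻¹)
    (hB : 0 < betaFun p q) :
    ∃ K : ℝ, 0 < K ∧ ∀ z ∈ betaPrimeDomain,
      z * (1 + z) * deriv f z = (p - 1 - (q + 1) * z) * f z + K := by
  have hw := integrableOn_betaPrimeWeight (s := p - 1) (t := p + q) (by linarith) (by linarith)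
  have hm := integral_betaPrimeWeight_pos (s := p - 1) (t := p + q) (by linarith) (by linarith)
  refine ⟨q * (∫ x in Ioi (0 : ℝ), betaPrimeWeight (p - 1) (p + q) x) / betaFun p q,
    by positivity, ?_⟩
  have hid : AnalyticOnNhd ℂ (fun z : ℂ => z) betaPrimeDomain := analyticOnNhd_id
  refine AnalyticOnNhd.eqOn_of_preconnected_of_eventuallyEq (z₀ := I)
    ((hid.mul (analyticOnNhd_const.add hid)).mul hf.deriv)
    (((analyticOnNhd_const.sub (analyticOnNhd_const.mul hid)).mul hf).add analyticOnNhd_const)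
    ?_ (by simp [betaPrimeDomain]) ?_
  · rw [betaPrimeDomain_eq_slitPlane]
    exact (starConvex_one_slitPlane.isPathConnected (by simp)).isConnected.isPreconnected
  filter_upwards [(isOpen_lt continuous_const continuous_im).mem_nhds
    (show (0 : ℝ) < I.im by simp)] with z hz
  have hI := integral_betaPrimeWeight_by_parts (a := p) (b := p + q - 1) hp (by linarith) hz
  have h1 := integrableOn_mul_comp_inv hw hz (P := fun u => u) (by fun_prop)
  have h2 := integrableOn_mul_comp_inv hw hz (P := fun u => u ^ 2) (by fun_prop)
  have h0 : IntegrableOn (fun x => (betaPrimeWeight (p - 1) (p + q) x : ℂ)) (Ioi 0) := hw.ofReal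
  have h12 : IntegrableOn (fun x => z * (1 + z) *
      ((betaPrimeWeight (p - 1) (p + q) x : ℂ) * (z - x)⁻¹ ^ 2) + (p - 1 - (q + 1) * z) *
      ((betaPrimeWeight (p - 1) (p + q) x : ℂ) * (z - x)⁻¹)) (Ioi 0) :=
    (h2.const_mul _).add (h1.const_mul _)
  have hsplit : z * (1 + z) * (∫ x in Ioi (0 : ℝ),
      (betaPrimeWeight (p - 1) (p + q) x : ℂ) * (z - x)⁻¹ ^ 2) +
      (p - 1 - (q + 1) * z) * (∫ x in Ioi (0 : ℝ),
        (betaPrimeWeight (p - 1) (p + q) x : ℂ) * (z - x)⁻¹) +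
      q * ∫ x in Ioi (0 : ℝ), (betaPrimeWeight (p - 1) (p + q) x : ℂ) = 0 := by
    rw [← hI, ← integral_const_mul, ← integral_const_mul, ← integral_const_mul,
      ← integral_add (h2.const_mul _) (h1.const_mul _),
      ← integral_add h12 (h0.const_mul _)]
    congr 1 with x
    rw [sub_add_cancel]
    push_cast
    ring
  rw [integral_complex_ofReal] at hsplit
  rw [(hd z hz).deriv, hagree z hz]
  push_cast
  linear_combination -(betaFun p q : ℂ)⁻¹ * hsplit

theorem stmt_13 (p q : ℝ) (hp : 0 < p) (hq : 0 < q)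
    (f : ℂ → ℂ) (hf : AnalyticOnNhd ℂ f betaPrimeDomain)
    (hagree : ∀ z : ℂ, 0 < z.im → f z = cauchyT (betaPrimeMeasure p q) z)
    (z : ℂ) (hzD : z ∈ betaPrimeDomain) (hzim : (f z).im < 0) :
    deriv f z ≠ 0 := by
  have hB : 0 < betaFun p q := betaFun_eq_beta hp hq ▸ ProbabilityTheory.beta_pos hp hq
  have hBC : (betaFun p q : ℂ) ≠ 0 := by exact_mod_cast hB.ne'
  have hw := integrableOn_betaPrimeWeight (s := p - 1) (t := p + q) (by linarith) (by linarith)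
  have hG : ∀ z : ℂ, 0 < z.im → f z = (betaFun p q : ℂ)⁻¹ *
      ∫ x in Ioi (0 : ℝ), (betaPrimeWeight (p - 1) (p + q) x : ℂ) * (z - x)⁻¹ :=
    fun z hz => (hagree z hz).trans (cauchyT_betaPrimeMeasure p q hB z)
  have hd : ∀ z : ℂ, 0 < z.im → HasDerivAt f (-((betaFun p q : ℂ)⁻¹ * ∫ x in Ioi (0 : ℝ),
      (betaPrimeWeight (p - 1) (p + q) x : ℂ) * (z - x)⁻¹ ^ 2)) z := by
    intro z hz
    rw [← mul_neg]
    refine ((hasDerivAt_integral_mul_inv_sub hw hz).const_mul _).congr_of_eventuallyEq ?_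
    filter_upwards [(isOpen_lt continuous_const continuous_im).mem_nhds hz] with w hw using hG w hw
  intro h0
  rcases lt_or_ge 0 z.im with hz | hz
  · rw [(hd z hz).deriv, neg_eq_zero, mul_eq_zero] at h0
    exact h0.elim (inv_ne_zero hBC) (integral_betaPrimeWeight_mul_inv_sq_ne_zero hp hq hz)
  · obtain ⟨K, hK, hode⟩ := exists_betaPrime_ode hp hq hf hd hG hB
    have e := hode z hzD
    rw [h0, mul_zero] at e
    have hre := congrArg re e
    have him := congrArg im e
    simp at hre him
    -- multiplying `((q+1)z - (p-1)) f(z) = K` by the conjugate of `f(z)` gives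
    -- `(q+1) Im z |f(z)|² = -K Im f(z)`
    have h1 : (q + 1) * z.im * ((f z).re ^ 2 + (f z).im ^ 2) = -K * (f z).im := by
      linear_combination (f z).re * him - (f z).im * hre
    have h2 : (q + 1) * z.im * ((f z).re ^ 2 + (f z).im ^ 2) ≤ 0 :=
      mul_nonpos_of_nonpos_of_nonneg (mul_nonpos_of_nonneg_of_nonpos (by positivity) hz)
        (by positivity)
    nlinarith [mul_pos hK (neg_pos.2 hzim)]
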